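/- arXiv:1504.02035 — 3 statements merged into one kernel-verified Lean document; each statement's English description precedes it below -/
import Mathlib

section
/- There is a constant C > 0 such that for all sufficiently large m and all positive integers n, s(m,n,2) ≤ C · m^{1 − 1/(4n+1)}. -/
/-- A Boolean decision tree over an `s`-bit memory: each internal node probes a
bit at an index in `[s]`, each leaf is marked Yes (`true`) or No (`false`). -/
inductive DTree (s : ℕ) : Type
  | leaf (b : Bool) : DTree s
  | node (i : Fin s) (f0 f1 : DTree s) : DTree s

/-- Depth of a decision tree. -/
def DTree.depth {s : ℕ} : DTree s → ℕ
  | .leaf _ => 0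
  | .node _ f0 f1 => max f0.depth f1.depth + 1

/-- Evaluating a decision tree on a memory `σ : Fin s → Bool`: at a node probing
index `i`, follow the edge labeled by the bit `σ i`. -/
def DTree.eval {s : ℕ} : DTree s → (Fin s → Bool) → Bool
  | .leaf b, _ => b
  | .node i f0 f1, σ => if σ i then f1.eval σ else f0.eval σ

/-- An `(m,n,s,t)`-scheme: a storing scheme `φ` mapping subsets of `[m]` of size at
most `n` to `s`-bit strings, together with a family of decision trees of depth at
most `t` answering membership queries correctly. -/
def SchemeExists (m n s t : ℕ) : Prop :=
  ∃ (φ : Finset (Fin m) → (Fin s → Bool)) (T : Fin m → DTree s),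
    (∀ u : Fin m, (T u).depth ≤ t) ∧
    ∀ S : Finset (Fin m), S.card ≤ n → ∀ u : Fin m, ((T u).eval (φ S) = true ↔ u ∈ S)

/-- `sFun m n t` is the minimum `s` such that an `(m,n,s,t)`-scheme exists. -/
noncomputable def sFun (m n t : ℕ) : ℕ := sInf {s : ℕ | SchemeExists m n s t}

section ForestConstruction

variable {ι A B : Type*} [DecidableEq A] [DecidableEq B] (α : ι → A)

/-- The right neighbours of the left vertex `a` in the bipartite graph whose edges `(e, b) ∈ E`
join `α e` to `b`. -/
def rightNeighbors (E : Finset (ι × B)) (a : A) : Finset B :=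
  (E.filter fun x => α x.1 = a).image Prod.snd

/-- The left neighbours of the right vertex `b`. -/
def leftNeighbors (E : Finset (ι × B)) (b : B) : Finset A :=
  (E.filter fun x => x.2 = b).image fun x => α x.1

/-- The right neighbours of `v` together with the right vertices at distance at most two
from `P`. -/
def ballStep (E : Finset (ι × B)) (v : A) (P : Finset B) : Finset B :=
  (insert v (P.biUnion (leftNeighbors α E))).biUnion (rightNeighbors α E)

/-- The right vertices at distance less than `2 * k` from the left vertex `v`. -/
def rightBall (E : Finset (ι × B)) (v : A) : ℕ → Finset B
  | 0 => ∅
  | k + 1 => ballStep α E v (rightBall E v k)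

/-- Edge sets built one edge at a time, each new edge joining vertices at distance at least
`2 * k`; such a graph has no cycle of length at most `2 * k`. -/
inductive LargeGirth [DecidableEq ι] (k : ℕ) : Finset (ι × B) → Prop
  | empty : LargeGirth k ∅
  | insert (E : Finset (ι × B)) (e : ι) (b : B) :
      LargeGirth k E → b ∉ rightBall α E (α e) k → LargeGirth k (insert (e, b) E)

lemma mem_rightNeighbors {E : Finset (ι × B)} {a : A} {b : B} :
    b ∈ rightNeighbors α E a ↔ ∃ e, (e, b) ∈ E ∧ α e = a := by
  simp [rightNeighbors]

lemma mem_leftNeighbors {E : Finset (ι × B)} {a : A} {b : B} :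
    a ∈ leftNeighbors α E b ↔ ∃ e, (e, b) ∈ E ∧ α e = a := by
  simp [leftNeighbors]

lemma ballStep_mono (E : Finset (ι × B)) (v : A) {P Q : Finset B} (h : P ⊆ Q) :
    ballStep α E v P ⊆ ballStep α E v Q :=
  Finset.biUnion_subset_biUnion_of_subset_left _
    (Finset.insert_subset_insert _ (Finset.biUnion_subset_biUnion_of_subset_left _ h))

lemma card_ballStep_le (E : Finset (ι × B)) (v : A) (P : Finset B) {D : ℕ}
    (hA : ∀ a, (E.filter fun x => α x.1 = a).card ≤ D)
    (hB : ∀ b, (E.filter fun x => x.2 = b).card ≤ D) :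
    (ballStep α E v P).card ≤ (P.card * D + 1) * D := by
  refine (Finset.card_biUnion_le_card_mul _ _ D fun a _ =>
    Finset.card_image_le.trans (hA a)).trans (Nat.mul_le_mul_right _ ?_)
  refine (Finset.card_insert_le _ _).trans (Nat.add_le_add_right ?_ 1)
  exact Finset.card_biUnion_le_card_mul _ _ D fun b _ => Finset.card_image_le.trans (hB b)

lemma card_rightBall_lt (E : Finset (ι × B)) (v : A) {D : ℕ} (hD : 2 ≤ D)
    (hA : ∀ a, (E.filter fun x => α x.1 = a).card ≤ D)
    (hB : ∀ b, (E.filter fun x => x.2 = b).card ≤ D) (k : ℕ) :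
    (rightBall α E v k).card + 1 ≤ D ^ (2 * k) := by
  induction k with
  | zero => simp [rightBall]
  | succ k ih =>
    have h := card_ballStep_le α E v (rightBall α E v k) hA hB
    have h1 := Nat.mul_le_mul_right (D * D) ih
    have h2 : D ^ (2 * (k + 1)) = D ^ (2 * k) * (D * D) := by ring
    rw [rightBall, h2]
    nlinarith

/-- Within at most `k` right vertices `M`, the component of `v` misses every right vertex
outside the ball of `v`. -/
lemma exists_component (E : Finset (ι × B)) (v : A) {k : ℕ} {M : Finset B} (hM : M.card ≤ k)
    {b : B} (hb : b ∉ rightBall α E v k) :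
    ∃ R : Set (A ⊕ B), Sum.inl v ∈ R ∧ Sum.inr b ∉ R ∧
      ∀ x ∈ E, x.2 ∈ M → (Sum.inl (α x.1) ∈ R ↔ Sum.inr x.2 ∈ R) := by
  let g : Finset B → Finset B := fun P => M ∩ ballStep α E v P
  have g_mono : Monotone g := fun P Q h =>
    Finset.inter_subset_inter_left (ballStep_mono α E v h)
  have growth : ∀ j, g^[j] ∅ ⊆ g^[j + 1] ∅ ∧ g^[j] ∅ ⊆ rightBall α E v j ∧
      (j ≤ (g^[j] ∅).card ∨ g (g^[j] ∅) = g^[j] ∅) := by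
    intro j
    induction j with
    | zero => simp
    | succ j ih =>
      obtain ⟨h1, h2, h3⟩ := ih
      simp only [Function.iterate_succ_apply'] at h1 ⊢
      refine ⟨g_mono h1, Finset.inter_subset_right.trans (ballStep_mono α E v h2), ?_⟩
      by_cases heq : g^[j] ∅ = g (g^[j] ∅)
      · right
        rw [← heq, ← heq]
      · left
        rcases h3 with h3 | h3
        · exact h3.trans_lt (Finset.card_lt_card (h1.ssubset_of_ne heq))
        · exact absurd h3.symm heq
  obtain ⟨P, hP, hball⟩ : ∃ P, g P = P ∧ P ⊆ rightBall α E v k := by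
    obtain ⟨-, h2, h3⟩ := growth k
    have hk : g (g^[k] ∅) = g^[k] ∅ := by
      rcases h3 with h3 | h3
      · by_contra hne
        have hsub : g^[k] ∅ ⊂ g (g^[k] ∅) := by
          have := (growth k).1
          rw [Function.iterate_succ_apply'] at this
          exact this.ssubset_of_ne (Ne.symm hne)
        have := Finset.card_lt_card hsub
        have : (g (g^[k] ∅)).card ≤ M.card := Finset.card_le_card Finset.inter_subset_left
        omega
      · exact h3
    exact ⟨_, hk, h2⟩
  refine ⟨{w | w = Sum.inl v ∨ (∃ a ∈ P.biUnion (leftNeighbors α E), w = Sum.inl a) ∨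
    ∃ c ∈ P, w = Sum.inr c}, Or.inl rfl, ?_, ?_⟩
  · simpa using fun h => hb (hball h)
  · rintro ⟨e, c⟩ hx hc
    constructor
    · intro h
      have ha : α e ∈ insert v (P.biUnion (leftNeighbors α E)) := by
        rcases h with h | ⟨a, ha, h⟩ | ⟨c, -, h⟩
        · simp [Sum.inl.inj h]
        · exact Finset.mem_insert_of_mem (Sum.inl.inj h ▸ ha)
        · cases h
      have hcP : c ∈ g P := Finset.mem_inter.2
        ⟨hc, Finset.mem_biUnion.2 ⟨_, ha, (mem_rightNeighbors α).2 ⟨e, hx, rfl⟩⟩⟩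
      exact Or.inr (Or.inr ⟨c, hP ▸ hcP, rfl⟩)
    · rintro (h | ⟨a, -, h⟩ | ⟨c', hc', h⟩)
      · cases h
      · cases h
      · cases h
        exact Or.inr (Or.inl ⟨α e,
          Finset.mem_biUnion.2 ⟨c, hc', (mem_leftNeighbors α).2 ⟨e, hx, rfl⟩⟩, rfl⟩)

/-- If each edge into a small set `M` of right vertices forbids one of the four pairs of values
at its ends, there is an assignment respecting all of them, with one value prescribed. -/
lemma LargeGirth.exists_assignment [DecidableEq ι] {k : ℕ} {E : Finset (ι × B)} (hE : LargeGirth α k E)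
    {M : Finset B} (hM : M.card ≤ k) (f : ι → Bool × Bool) (w : A ⊕ B) (y : Bool) :
    ∃ ρ : A ⊕ B → Bool, ρ w = y ∧
      ∀ x ∈ E, x.2 ∈ M → (ρ (Sum.inl (α x.1)), ρ (Sum.inr x.2)) ≠ f x.1 := by
  classical
  induction hE generalizing w y with
  | empty => exact ⟨fun _ => y, rfl, by simp⟩
  | insert E e b _ hb ih =>
    obtain ⟨R, hv, hbR, hR⟩ := exists_component α E (α e) hM hb
    obtain ⟨ρ₁, ρ₂, hw, h₁, h₂, hnew⟩ : ∃ ρ₁ ρ₂ : A ⊕ B → Bool,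
        (if w ∈ R then ρ₁ w else ρ₂ w) = y ∧
        (∀ x ∈ E, x.2 ∈ M → (ρ₁ (Sum.inl (α x.1)), ρ₁ (Sum.inr x.2)) ≠ f x.1) ∧
        (∀ x ∈ E, x.2 ∈ M → (ρ₂ (Sum.inl (α x.1)), ρ₂ (Sum.inr x.2)) ≠ f x.1) ∧
        (ρ₁ (Sum.inl (α e)), ρ₂ (Sum.inr b)) ≠ f e := by
      by_cases hw : w ∈ R
      · obtain ⟨ρ₁, hy, h₁⟩ := ih w y
        obtain ⟨ρ₂, hz, h₂⟩ := ih (Sum.inr b) (!(f e).2)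
        refine ⟨ρ₁, ρ₂, by simp [hw, hy], h₁, h₂, fun h => ?_⟩
        simp [← h] at hz
      · obtain ⟨ρ₂, hy, h₂⟩ := ih w y
        obtain ⟨ρ₁, hz, h₁⟩ := ih (Sum.inl (α e)) (!(f e).1)
        refine ⟨ρ₁, ρ₂, by simp [hw, hy], h₁, h₂, fun h => ?_⟩
        simp [← h] at hz
    refine ⟨fun u => if u ∈ R then ρ₁ u else ρ₂ u, hw, fun x hx hxM => ?_⟩
    rcases Finset.mem_insert.1 hx with rfl | hx
    · simpa [hv, hbR] using hnew
    · by_cases hin : Sum.inr x.2 ∈ R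
      · simpa [hin, (hR x hx hxM).2 hin] using h₁ x hx hxM
      · simpa [hin, mt (hR x hx hxM).1 hin] using h₂ x hx hxM

/-- Greedy construction of dense bipartite graphs of large girth with prescribed left ends. -/
lemma exists_largeGirth [DecidableEq ι] [Fintype ι] [Fintype B] {k D : ℕ} (hD : 2 ≤ D)
    (hα : ∀ a, (Finset.univ.filter fun e => α e = a).card ≤ D)
    (hB : Fintype.card ι / D + D ^ (2 * k) ≤ Fintype.card B) :
    ∃ β : ι → B, ∃ E : Finset (ι × B), LargeGirth α k E ∧ ∀ e, (e, β e) ∈ E := by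
  have key : ∀ I : Finset ι, ∃ E : Finset (ι × B), LargeGirth α k E ∧
      (∀ e ∈ I, ∃ b, (e, b) ∈ E) ∧ E.card ≤ I.card ∧
      (∀ a, (E.filter fun x => α x.1 = a).card ≤ (I.filter fun e => α e = a).card) ∧
      ∀ b, (E.filter fun x => x.2 = b).card ≤ D := by
    intro I
    induction I using Finset.induction_on with
    | empty => exact ⟨∅, .empty, by simp⟩
    | insert e I he ih =>
      obtain ⟨E, hE, hI, hcard, hA, hdeg⟩ := ih
      let full : Finset B := Finset.univ.filter fun b => D ≤ (E.filter fun x => x.2 = b).card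
      have hfull : full.card ≤ Fintype.card ι / D := by
        rw [Nat.le_div_iff_mul_le (by omega)]
        refine le_trans ?_ (hcard.trans (Finset.card_le_univ I))
        calc full.card * D ≤ ∑ b ∈ full, (E.filter fun x => x.2 = b).card :=
              Finset.card_nsmul_le_sum _ _ _ fun b hb => (Finset.mem_filter.1 hb).2
          _ ≤ ∑ b, (E.filter fun x => x.2 = b).card :=
              Finset.sum_le_sum_of_subset (Finset.subset_univ _)
          _ = E.card := (Finset.card_eq_sum_card_fiberwise fun x _ => Finset.mem_univ x.2).symm
      have hball := card_rightBall_lt α E (α e) hD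
        (fun a => (hA a).trans ((Finset.card_le_card
          (Finset.filter_subset_filter _ (Finset.subset_univ I))).trans (hα a))) hdeg k
      obtain ⟨b, hb⟩ : ∃ b, b ∉ full ∪ rightBall α E (α e) k := by
        by_contra! h
        have h1 := Finset.card_union_le full (rightBall α E (α e) k)
        rw [Finset.eq_univ_iff_forall.2 h, Finset.card_univ] at h1
        omega
      rw [Finset.notMem_union] at hb
      refine ⟨insert (e, b) E, .insert E e b hE hb.2, ?_, ?_, ?_, ?_⟩
      · intro e' he'
        rcases Finset.mem_insert.1 he' with rfl | he'
        · exact ⟨b, Finset.mem_insert_self _ _⟩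
        · obtain ⟨b', hb'⟩ := hI e' he'
          exact ⟨b', Finset.mem_insert_of_mem hb'⟩
      · rw [Finset.card_insert_of_notMem he]
        exact (Finset.card_insert_le _ _).trans (by omega)
      · intro a
        rw [Finset.filter_insert, Finset.filter_insert]
        split_ifs
        · rw [Finset.card_insert_of_notMem (a := e) (by simp [he])]
          exact (Finset.card_insert_le _ _).trans (Nat.add_le_add_right (hA a) 1)
        · exact hA a
      · intro b'
        rw [Finset.filter_insert]
        split_ifs with h
        · have hlt : (E.filter fun x => x.2 = b').card < D := by
            simpa [full, ← h] using hb.1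
          exact (Finset.card_insert_le _ _).trans hlt
        · exact hdeg b'
  obtain ⟨E, hE, hex, -⟩ := key Finset.univ
  choose β hβ using fun e => hex e (Finset.mem_univ e)
  exact ⟨β, E, hE, hβ⟩

end ForestConstruction

/-- Storing the characteristic vector. -/
lemma schemeExists_self (m n : ℕ) : SchemeExists m n m 2 :=
  ⟨fun S u => decide (u ∈ S), fun u => .node u (.leaf false) (.leaf true),
    fun u => by simp [DTree.depth], fun S _ u => by by_cases h : u ∈ S <;> simp [DTree.eval, h]⟩

lemma schemeExists_two (m n K : ℕ) (hK : 1 ≤ K) :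
    SchemeExists m n (m / K + 1 + (m / K + (2 * K) ^ (4 * n))) 2 := by
  let α : Fin m × Bool → Fin (m / K + 1) := fun e =>
    ⟨e.1 / K, Nat.lt_succ_of_le (Nat.div_le_div_right e.1.2.le)⟩
  have hα : ∀ a, (Finset.univ.filter fun e => α e = a).card ≤ 2 * K := by
    intro a
    have hmaps : Set.MapsTo (fun e : Fin m × Bool => ((e.1 : ℕ) % K, e.2))
        (Finset.univ.filter fun e => α e = a)
        (Finset.range K ×ˢ (Finset.univ : Finset Bool)) := by
      intro e _
      simpa using Nat.mod_lt _ hK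
    have hinj : Set.InjOn (fun e : Fin m × Bool => ((e.1 : ℕ) % K, e.2))
        (Finset.univ.filter fun e => α e = a) := by
      rintro ⟨u, r⟩ hu ⟨u', r'⟩ hu' h
      simp only [Finset.coe_filter, Finset.mem_univ, true_and, Set.mem_ofPred_eq] at hu hu'
      have hdiv : (u : ℕ) / K = u' / K := congrArg Fin.val (hu.trans hu'.symm)
      simp only [Prod.mk.injEq] at h
      have huu : (u : ℕ) = u' := by
        rw [← Nat.div_add_mod (u : ℕ) K, ← Nat.div_add_mod (u' : ℕ) K, hdiv, h.1]
      exact Prod.ext (Fin.ext huu) h.2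
    have := Finset.card_le_card_of_injOn _ (by exact_mod_cast hmaps) hinj
    simpa [mul_comm] using this
  obtain ⟨β, E, hE, hβ⟩ := exists_largeGirth (B := Fin (m / K + (2 * K) ^ (4 * n))) α
    (k := 2 * n) (by omega) hα (by
      have h : m * 2 / (2 * K) = m / K := by
        rw [mul_comm m 2, Nat.mul_div_mul_left _ _ (by norm_num)]
      have h' : 2 * (2 * n) = 4 * n := by ring
      simp [h, h'])
  let marked : Finset (Fin m) → Finset (Fin (m / K + (2 * K) ^ (4 * n))) := fun S =>
    (S ×ˢ (Finset.univ : Finset Bool)).image β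
  have hmarked : ∀ S : Finset (Fin m), S.card ≤ n → (marked S).card ≤ 2 * n := by
    intro S hS
    refine Finset.card_image_le.trans ?_
    simp
    omega
  have hstore : ∀ S : Finset (Fin m), ∃ σ : Fin (m / K + 1) → Bool,
      ∃ τ : Fin (m / K + (2 * K) ^ (4 * n)) → Bool,
        S.card ≤ n → ∀ u, τ (β (u, σ (α (u, false)))) = decide (u ∈ S) := by
    intro S
    by_cases hS : S.card ≤ n
    · obtain ⟨ρ, -, hρ⟩ := hE.exists_assignment α (hmarked S hS)
        (fun e => (e.2, !decide (e.1 ∈ S))) (Sum.inl 0) false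
      refine ⟨fun a => ρ (Sum.inl a), fun b => decide (b ∈ marked S) && ρ (Sum.inr b),
        fun _ u => ?_⟩
      beta_reduce
      generalize hr : ρ (Sum.inl (α (u, false))) = r
      by_cases hb : β (u, r) ∈ marked S
      · have h := hρ _ (hβ (u, r)) hb
        have hr' : ρ (Sum.inl (α (u, r))) = r := hr
        simp only [hr', ne_eq, Prod.mk.injEq, true_and] at h
        simpa [hb] using h
      · have hu : u ∉ S := fun hu => hb (Finset.mem_image_of_mem _ (by simp [hu]))
        simp [hb, hu]
    · exact ⟨fun _ => false, fun _ => false, fun h => absurd h hS⟩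
  choose σ τ hστ using hstore
  refine ⟨fun S => Fin.append (σ S) (τ S), fun u => .node (Fin.castAdd _ (α (u, false)))
    (.node (Fin.natAdd _ (β (u, false))) (.leaf false) (.leaf true))
    (.node (Fin.natAdd _ (β (u, true))) (.leaf false) (.leaf true)), ?_, ?_⟩
  · intro u
    simp [DTree.depth]
  · intro S hS u
    have h := hστ S hS u
    cases hr : σ S (α (u, false)) <;> rw [hr] at h <;>
      by_cases hu : u ∈ S <;> simp [DTree.eval, hr, h, hu]

/-- There is a constant `C > 0` such that for all sufficiently large `m` and all
positive integers `n`, `s(m,n,2) ≤ C · m^(1 - 1/(4n+1))`. -/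
theorem two_probe_upper_bound :
    ∃ C : ℝ, 0 < C ∧ ∃ M : ℕ, ∀ m : ℕ, M ≤ m → ∀ n : ℕ, 1 ≤ n →
      (sFun m n 2 : ℝ) ≤ C * (m : ℝ) ^ ((1 : ℝ) - 1 / (4 * (n : ℝ) + 1)) := by
  refine ⟨10, by norm_num, 1, fun m hm n _ => ?_⟩
  have hm' : (1 : ℝ) ≤ m := by exact_mod_cast hm
  set x : ℝ := (m : ℝ) ^ (1 / (4 * (n : ℝ) + 1)) with hx
  set z : ℝ := (m : ℝ) ^ ((1 : ℝ) - 1 / (4 * (n : ℝ) + 1)) with hz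
  have hexp : (1 : ℝ) / (4 * n + 1) ≤ 1 := by
    rw [div_le_one (by positivity)]
    linarith [(Nat.cast_nonneg n : (0 : ℝ) ≤ n)]
  have hzx : z * x = m := by
    rw [hz, hx, ← Real.rpow_add (by linarith)]
    simp
  have hz1 : 1 ≤ z := Real.one_le_rpow hm' (by linarith)
  have hxz : x ^ (4 * n) = z := by
    rw [hx, hz, ← Real.rpow_natCast, ← Real.rpow_mul (by linarith)]
    congr 1
    push_cast
    field_simp
    ring
  by_cases hx4 : x < 4
  · have h : (sFun m n 2 : ℝ) ≤ m := by
      exact_mod_cast Nat.sInf_le (schemeExists_self m n)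
    nlinarith
  · push Not at hx4
    set K := ⌊x / 2⌋₊ with hKdef
    have hKle : (K : ℝ) ≤ x / 2 := Nat.floor_le (by linarith)
    have hKgt : x / 2 < K + 1 := Nat.lt_floor_add_one _
    have hK : 1 ≤ K := by
      have : (0 : ℝ) < K := by linarith
      exact_mod_cast this
    have h : (sFun m n 2 : ℝ) ≤ ((m / K + 1 + (m / K + (2 * K) ^ (4 * n)) : ℕ) : ℝ) := by
      exact_mod_cast Nat.sInf_le (schemeExists_two m n K hK)
    have hdiv : ((m / K : ℕ) : ℝ) ≤ 4 * z := by
      refine Nat.cast_div_le.trans ?_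
      rw [div_le_iff₀ (by linarith)]
      nlinarith
    have hpow : (2 * (K : ℝ)) ^ (4 * n) ≤ z :=
      hxz ▸ pow_le_pow_left₀ (by positivity) (by linarith) _
    push_cast at h
    linarith
end

section
/- There is a constant C > 0 such that for every odd integer t ≥ 5, for all sufficiently large m and all integers n with 1 ≤ n ≤ m, there exists a non-adaptive (m,n,s,t)-scheme with s ≤ C · t · m^{2/(t−1)} · n^{1 − 2/(t−1)} · log₂(2m/n). -/
/-- A non-adaptive `(m,n,s,t)`-scheme: each element `u` has a fixed sequence of
`t` probe locations `p u` (independent of the bits read) and an output function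
`f u` of the bits read; a storing scheme `φ` maps each subset of `[m]` of size at
most `n` to an `s`-bit string so that all membership queries are answered
correctly. -/
def NonAdaptiveSchemeExists (m n s t : ℕ) : Prop :=
  ∃ (p : Fin m → Fin t → Fin s) (f : Fin m → (Fin t → Bool) → Bool)
    (φ : Finset (Fin m) → (Fin s → Bool)),
    ∀ S : Finset (Fin m), S.card ≤ n → ∀ u : Fin m,
      (f u (fun i => φ S (p u i)) = true ↔ u ∈ S)

section

open Finset

theorem choose_le_three_mul_div_pow (m w : ℕ) :
    (m.choose w : ℝ) ≤ (3 * m / w : ℝ) ^ w := by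
  rcases Nat.eq_zero_or_pos w with rfl | hw
  · simp
  have hexp : (w : ℝ) ^ w ≤ 3 ^ w * (w.factorial : ℝ) := by
    have h := Real.pow_div_factorial_le_exp (w : ℝ) (by positivity) w
    rw [div_le_iff₀ (by positivity)] at h
    refine h.trans ?_
    gcongr
    rw [← mul_one (w : ℝ), Real.exp_nat_mul]
    gcongr
    exact Real.exp_one_lt_three.le
  refine (Nat.choose_le_pow_div w m).trans ?_
  rw [div_pow, mul_pow, div_le_div_iff₀ (by positivity) (by positivity)]
  calc (m : ℝ) ^ w * (w : ℝ) ^ w ≤ (m : ℝ) ^ w * (3 ^ w * (w.factorial : ℝ)) := by gcongr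
    _ = _ := by ring

theorem card_filter_forall_mem_le {U A : Type*} [Fintype U] [DecidableEq U] [Fintype A]
    [DecidableEq A] (T : Finset U) (Q : (U → A) → Finset A)
    [DecidablePred fun p : U → A => ∀ u ∈ T, p u ∈ Q p]
    (hQ : ∀ p p' : U → A, (∀ u ∉ T, p u = p' u) → Q p = Q p') {x : ℝ} (hx : 0 ≤ x)
    (hcard : ∀ p, (#(Q p) : ℝ) ≤ x * Fintype.card A) :
    (#{p : U → A | ∀ u ∈ T, p u ∈ Q p} : ℝ) ≤ x ^ #T * (Fintype.card (U → A) : ℝ) := by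
  classical
  let ρ : (U → A) → ({u // u ∉ T} → A) := fun p u => p u
  set F : Finset (U → A) := {p : U → A | ∀ u ∈ T, p u ∈ Q p} with hF
  have hfiber : ∀ b, (#{p ∈ F | ρ p = b} : ℝ) ≤ (x * Fintype.card A) ^ #T := by
    intro b
    rcases (F.filter (ρ · = b)).eq_empty_or_nonempty with h0 | ⟨p₀, hp₀⟩
    · rw [h0]; simp only [card_empty, Nat.cast_zero]; positivity
    have hsub : F.filter (ρ · = b) ⊆
        Fintype.piFinset (fun u => if u ∈ T then Q p₀ else {p₀ u}) := by
      intro p hp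
      rw [mem_filter] at hp hp₀
      have hagree : ∀ u ∉ T, p u = p₀ u := fun u hu =>
        congrFun (hp.2.trans hp₀.2.symm) ⟨u, hu⟩
      rw [Fintype.mem_piFinset]
      intro u
      split_ifs with hu
      · rw [← hQ p p₀ hagree]
        exact (mem_filter.1 hp.1).2 u hu
      · simpa using hagree u hu
    have hc : #(Fintype.piFinset (fun u => if u ∈ T then Q p₀ else {p₀ u})) = #(Q p₀) ^ #T := by
      rw [Fintype.card_piFinset]
      simp only [apply_ite card, card_singleton]
      rw [prod_ite_mem, univ_inter, prod_const]
    calc (#(F.filter (ρ · = b)) : ℝ) ≤ (#(Q p₀) : ℝ) ^ #T := by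
          exact_mod_cast (card_le_card hsub).trans hc.le
      _ ≤ _ := by gcongr; exact hcard p₀
  have hsum : (#F : ℝ) = ∑ b, (#{p ∈ F | ρ p = b} : ℝ) := by
    exact_mod_cast card_eq_sum_card_fiberwise (f := ρ) (s := F) (t := univ) (by simp)
  have hcompl : Fintype.card {u // u ∉ T} + #T = Fintype.card U := by
    rw [Fintype.card_subtype_compl, Fintype.card_coe]
    exact Nat.sub_add_cancel (card_le_univ T)
  calc (#F : ℝ) ≤ ∑ _b : {u // u ∉ T} → A, (x * Fintype.card A : ℝ) ^ #T :=
        hsum.trans_le (sum_le_sum fun b _ => hfiber b)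
    _ = x ^ #T * (Fintype.card (U → A) : ℝ) := by
        rw [sum_const, card_univ, Fintype.card_fun, Fintype.card_fun, ← hcompl, nsmul_eq_mul,
          mul_pow, pow_add]
        push_cast
        ring

theorem card_filter_le_card_filter_mem {s t : ℕ} (Y : Finset (Fin s)) (hs : 0 < s) (k : ℕ) :
    (#{q : Fin t → Fin s | k ≤ #{i | q i ∈ Y}} : ℝ) ≤
      2 ^ t * (#Y / s : ℝ) ^ k * (Fintype.card (Fin t → Fin s) : ℝ) := by
  classical
  have hs' : (0 : ℝ) < s := by exact_mod_cast hs
  have hsub : ({q : Fin t → Fin s | k ≤ #{i | q i ∈ Y}} : Finset _) ⊆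
      (powersetCard k (univ : Finset (Fin t))).biUnion
        (fun I => {q : Fin t → Fin s | ∀ i ∈ I, q i ∈ Y}) := by
    intro q hq
    obtain ⟨I, hI, hIk⟩ := exists_subset_card_eq (mem_filter.1 hq).2
    refine mem_biUnion.2 ⟨I, mem_powersetCard.2 ⟨subset_univ _, hIk⟩, ?_⟩
    simpa using fun i hi => (mem_filter.1 (hI hi)).2
  calc (#{q : Fin t → Fin s | k ≤ #{i | q i ∈ Y}} : ℝ)
      ≤ ∑ I ∈ powersetCard k (univ : Finset (Fin t)),
          (#{q : Fin t → Fin s | ∀ i ∈ I, q i ∈ Y} : ℝ) := by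
        exact_mod_cast (card_le_card hsub).trans card_biUnion_le
    _ ≤ ∑ I ∈ powersetCard k (univ : Finset (Fin t)),
          (#Y / s : ℝ) ^ k * (Fintype.card (Fin t → Fin s) : ℝ) := by
        refine sum_le_sum fun I hI => ?_
        rw [← (mem_powersetCard.1 hI).2]
        refine card_filter_forall_mem_le (x := (#Y / s : ℝ)) I (fun _ => Y) (fun _ _ _ => rfl)
          (by positivity) ?_
        intro _
        rw [Fintype.card_fin, div_mul_cancel₀ _ hs'.ne']
    _ ≤ _ := by
        rw [sum_const, card_powersetCard, card_univ, Fintype.card_fin, nsmul_eq_mul, mul_assoc]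
        gcongr
        exact_mod_cast Nat.choose_le_two_pow t k

/-- The cells probed by at least one query in `W`. -/
def probedCells {m s t : ℕ} (p : Fin m → Fin t → Fin s) (W : Finset (Fin m)) :
    Finset (Fin s) :=
  W.biUnion fun u => univ.image (p u)

theorem card_probedCells_le {m s t : ℕ} (p : Fin m → Fin t → Fin s) (W : Finset (Fin m)) :
    #(probedCells p W) ≤ #W * t :=
  card_biUnion_le_card_mul _ _ _ fun u _ => card_image_le.trans (by simp)

theorem exists_injective_of_expansion {m s t k : ℕ} (p : Fin m → Fin t → Fin s)
    (W : Finset (Fin m)) (hW : ∀ V ⊆ W, k * #V ≤ #(probedCells p V)) :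
    ∃ g : W → Fin k → Fin t, Function.Injective fun x : W × Fin k => p x.1 (g x.1 x.2) := by
  classical
  obtain ⟨f, hf, hmem⟩ := (all_card_le_biUnion_card_iff_exists_injective
    (fun x : W × Fin k => univ.image (p x.1))).1 (by
      intro Z
      set V : Finset (Fin m) := Z.image fun x => (x.1 : Fin m) with hV
      have hVW : V ⊆ W := by
        intro u hu
        obtain ⟨x, -, rfl⟩ := mem_image.1 hu
        exact x.1.2
      have hcells : probedCells p V = Z.biUnion fun x => univ.image (p x.1) := by
        rw [probedCells, hV, image_biUnion]
      rw [← hcells]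
      refine le_trans ?_ (hW V hVW)
      refine card_le_mul_card_image Z k fun u _ => ?_
      refine (card_le_card_of_injOn (t := (univ : Finset (Fin k))) Prod.snd (by simp) ?_).trans
        (by simp)
      intro x hx y hy hxy
      rw [mem_coe, mem_filter] at hx hy
      exact Prod.ext (Subtype.ext (hx.2.trans hy.2.symm)) hxy)
  have hex : ∀ (u : W) (j : Fin k), ∃ i, p u i = f (u, j) := by
    intro u j
    simpa using hmem (u, j)
  choose g hg using hex
  refine ⟨g, ?_⟩
  simpa only [hg] using hf

theorem exists_storage {m s t k : ℕ} (ht : t < 2 * k) (p : Fin m → Fin t → Fin s)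
    (S S' W : Finset (Fin m)) (hSS' : S ⊆ S') (hSW : S ⊆ W)
    (hW : ∀ V ⊆ W, k * #V ≤ #(probedCells p V))
    (hout : ∀ u ∉ W, #{i | p u i ∈ probedCells p S'} < k) :
    ∃ y : Fin s → Bool, ∀ u, (decide (k ≤ #{i | y (p u i) = true}) = true ↔ u ∈ S) := by
  classical
  obtain ⟨g, hg⟩ := exists_injective_of_expansion p W hW
  have hgu : ∀ u, Function.Injective (g u) := by
    intro u j j' h
    have := @hg (u, j) (u, j') (by simp [h])
    exact (Prod.ext_iff.1 this).2
  refine ⟨fun c => decide (∃ (v : {u // u ∈ W}) (j : Fin k), (v : Fin m) ∈ S ∧ p v (g v j) = c), fun u => ?_⟩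
  simp only [decide_eq_true_eq]
  constructor
  · intro hk
    by_contra hu
    by_cases huW : u ∈ W
    · have hfalse : k ≤ #{i | ¬ ∃ (v : {u // u ∈ W}) (j : Fin k), (v : Fin m) ∈ S ∧ p v (g v j) = p u i} := by
        calc k = #(univ.image (g ⟨u, huW⟩)) := by
              rw [card_image_of_injective _ (hgu _), card_univ, Fintype.card_fin]
          _ ≤ _ := by
              refine card_le_card fun i hi => ?_
              obtain ⟨j, -, rfl⟩ := mem_image.1 hi
              refine mem_filter.2 ⟨mem_univ _, ?_⟩
              rintro ⟨v, j', hv, h⟩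
              have := @hg (v, j') (⟨u, huW⟩, j) h
              rw [show v = ⟨u, huW⟩ from (Prod.ext_iff.1 this).1] at hv
              exact hu hv
      have := card_filter_add_card_filter_not (s := (univ : Finset (Fin t)))
        (fun i => ∃ (v : {u // u ∈ W}) (j : Fin k), (v : Fin m) ∈ S ∧ p v (g v j) = p u i)
      rw [card_univ, Fintype.card_fin] at this
      omega
    · refine absurd (hout u huW) (not_lt.2 (hk.trans (card_le_card ?_)))
      intro i hi
      obtain ⟨v, j, hv, h⟩ := (mem_filter.1 hi).2
      refine mem_filter.2 ⟨mem_univ _, ?_⟩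
      rw [← h]
      exact mem_biUnion.2 ⟨v, hSS' hv, mem_image_of_mem _ (mem_univ _)⟩
  · intro hu
    calc k = #(univ.image (g ⟨u, hSW hu⟩)) := by
          rw [card_image_of_injective _ (hgu _), card_univ, Fintype.card_fin]
      _ ≤ _ := by
          refine card_le_card fun i hi => ?_
          obtain ⟨j, -, rfl⟩ := mem_image.1 hi
          exact mem_filter.2 ⟨mem_univ _, ⟨u, hSW hu⟩, j, hu, rfl⟩

theorem card_filter_crowded_le {m s t n k : ℕ} (hs : 0 < s) {S T : Finset (Fin m)}
    (hS : #S = n) (hST : Disjoint S T) :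
    (#{p : Fin m → Fin t → Fin s | ∀ u ∈ T, k ≤ #{i | p u i ∈ probedCells p S}} : ℝ) ≤
      (2 ^ t * (n * t / s : ℝ) ^ k) ^ #T * (Fintype.card (Fin m → Fin t → Fin s) : ℝ) := by
  classical
  have h := card_filter_forall_mem_le (x := (2 ^ t * (n * t / s : ℝ) ^ k)) T
    (fun p : Fin m → Fin t → Fin s =>
      ({q | k ≤ #{i | q i ∈ probedCells p S}} : Finset (Fin t → Fin s))) ?_ (by positivity) ?_
  · simpa using h
  · intro p p' hpp'
    have : probedCells p S = probedCells p' S :=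
      biUnion_congr rfl fun u hu => by rw [hpp' u (disjoint_left.1 hST hu)]
    simp only [this]
  · intro p
    refine (card_filter_le_card_filter_mem _ hs k).trans ?_
    have hc : (#(probedCells p S) : ℝ) ≤ n * t := by
      exact_mod_cast hS ▸ card_probedCells_le p S
    gcongr

theorem card_filter_confined_le {m s t : ℕ} (hs : 0 < s) (W : Finset (Fin m))
    (Y : Finset (Fin s)) :
    (#{p : Fin m → Fin t → Fin s | probedCells p W ⊆ Y} : ℝ) ≤
      ((#Y / s : ℝ) ^ t) ^ #W * (Fintype.card (Fin m → Fin t → Fin s) : ℝ) := by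
  classical
  have hs' : (0 : ℝ) < s := by exact_mod_cast hs
  have h := card_filter_forall_mem_le (x := (#Y / s : ℝ) ^ t) W
    (fun _ : Fin m → Fin t → Fin s => Fintype.piFinset fun _ => Y) (fun _ _ _ => rfl)
    (by positivity) ?_
  · refine le_trans ?_ h
    refine Nat.cast_le.2 (card_le_card fun p hp => ?_)
    refine mem_filter.2 ⟨mem_univ _, fun u hu => Fintype.mem_piFinset.2 fun i => ?_⟩
    exact (mem_filter.1 hp).2 (mem_biUnion.2 ⟨u, hu, mem_image_of_mem _ (mem_univ _)⟩)
  · intro _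
    rw [Fintype.card_piFinset, prod_const, card_univ, Fintype.card_fin, Fintype.card_fun,
      Fintype.card_fin, Fintype.card_fin]
    push_cast
    rw [← mul_pow, div_mul_cancel₀ _ (by positivity)]

/-- The space `s` is at least `128 k m^{1/r} N^{1-1/r}` with `r = l + 1`, `k = l + 2`. -/
def SpaceBound (m N l s : ℕ) : Prop :=
  (128 * (l + 2)) ^ (l + 1) * (m * N ^ l) ≤ s ^ (l + 1)

theorem SpaceBound.pos {m N l s : ℕ} (h : SpaceBound m N l s) (hm : 0 < m) (hN : 0 < N) :
    0 < s := by
  rcases Nat.eq_zero_or_pos s with rfl | hs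
  · have : 0 < (128 * (l + 2)) ^ (l + 1) * (m * N ^ l) := by positivity
    unfold SpaceBound at h
    rw [zero_pow (by omega)] at h
    omega
  · exact hs

theorem SpaceBound.load_pow_mul_le {m N l s w : ℕ} (h : SpaceBound m N l s) (hs : 0 < s)
    (hw : 0 < w) (hwN : w ≤ N) :
    (((l + 2 : ℕ) * w : ℝ) / s) ^ (l + 1) * m ≤ w / 128 ^ (l + 1) := by
  have hs' : (0 : ℝ) < s := by exact_mod_cast hs
  have h' : ((128 * (l + 2 : ℕ)) ^ (l + 1) * (m * N ^ l) : ℝ) ≤ s ^ (l + 1) := by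
    exact_mod_cast h
  rw [div_pow, div_mul_eq_mul_div, div_le_div_iff₀ (by positivity) (by positivity)]
  calc (((l + 2 : ℕ) * w : ℝ)) ^ (l + 1) * m * 128 ^ (l + 1)
      = w * ((128 * (l + 2 : ℕ)) ^ (l + 1) * (m * w ^ l)) := by
        rw [mul_pow, mul_pow, pow_succ (w : ℝ) l]; ring
    _ ≤ w * ((128 * (l + 2 : ℕ)) ^ (l + 1) * (m * N ^ l)) := by gcongr
    _ ≤ w * s ^ (l + 1) := by gcongr

theorem SpaceBound.load_le_one {m N l s w : ℕ} (h : SpaceBound m N l s) (hs : 0 < s)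
    (hw : 0 < w) (hwN : w ≤ N) (hwm : w ≤ 2 * m) :
    (((l + 2 : ℕ) * w : ℝ) / s) ≤ 1 := by
  have hm : (0 : ℝ) < m := by exact_mod_cast (by omega : 0 < m)
  have hwm' : (w : ℝ) ≤ 2 * m := by exact_mod_cast hwm
  have h1 := h.load_pow_mul_le hs hw hwN
  have h2 : (w : ℝ) / 128 ^ (l + 1) ≤ m := by
    rw [div_le_iff₀ (by positivity)]
    have : (2 : ℝ) ≤ 128 ^ (l + 1) := by
      calc (2 : ℝ) ≤ 128 ^ 1 := by norm_num
        _ ≤ 128 ^ (l + 1) := pow_le_pow_right₀ (by norm_num) (by omega)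
    nlinarith
  have h3 : (((l + 2 : ℕ) * w : ℝ) / s) ^ (l + 1) ≤ 1 := by
    by_contra! hlt
    nlinarith
  exact (pow_le_one_iff_of_nonneg (by positivity) (by omega)).1 h3

theorem SpaceBound.confined_le {m N l s w : ℕ} (h : SpaceBound m N l s) (hs : 0 < s)
    (hw : 0 < w) (hwN : w ≤ N) :
    (m.choose w : ℝ) * (s.choose ((l + 2) * w) *
      (((((l + 2) * w : ℕ) : ℝ) / s) ^ (2 * l + 3)) ^ w) ≤ (1 / 4) ^ w := by
  have hs' : (0 : ℝ) < s := by exact_mod_cast hs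
  have hw' : (0 : ℝ) < w := by exact_mod_cast hw
  have hload := h.load_pow_mul_le hs hw hwN
  have hcs := choose_le_three_mul_div_pow s ((l + 2) * w)
  push_cast at hload hcs ⊢
  set y : ℝ := ((l + 2 : ℝ) * w) / s with hy
  have hy0 : 0 < y := by positivity
  have h3 : (3 * s / ((l + 2 : ℝ) * w)) = 3 / y := by
    rw [hy]; field_simp
  rw [h3, pow_mul] at hcs
  calc (m.choose w : ℝ) * (s.choose ((l + 2) * w) * (y ^ (2 * l + 3)) ^ w)
      ≤ (3 * m / w) ^ w * (((3 / y) ^ (l + 2)) ^ w * (y ^ (2 * l + 3)) ^ w) := by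
        gcongr
        exact choose_le_three_mul_div_pow m w
    _ = (3 ^ (l + 3) / w * (y ^ (l + 1) * m)) ^ w := by
        rw [← mul_pow, ← mul_pow]
        congr 1
        rw [div_pow, show 2 * l + 3 = (l + 2) + (l + 1) by ring, pow_add y]
        field_simp
        ring
    _ ≤ (3 ^ (l + 3) / w * (w / 128 ^ (l + 1))) ^ w := by gcongr
    _ ≤ (1 / 4) ^ w := by
        gcongr
        have : (3 ^ (l + 3) / w * (w / 128 ^ (l + 1)) : ℝ) = 9 * (3 / 128) ^ (l + 1) := by
          rw [div_pow, show l + 3 = 2 + (l + 1) by ring, pow_add]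
          field_simp
          norm_num
        rw [this]
        have : (3 / 128 : ℝ) ^ (l + 1) ≤ 3 / 128 :=
          pow_le_of_le_one (by norm_num) (by norm_num) (by omega)
        linarith

theorem SpaceBound.crowded_le {m n K l s : ℕ} (hl : 1 ≤ l) (hn : 1 ≤ n) (hnm : n ≤ m)
    (hK : 1 ≤ K) (hmK : m < n * 2 ^ K) (h : SpaceBound m (2 * (n * K)) l s) (hs : 0 < s) :
    (m.choose n : ℝ) * (m.choose (n * K) *
      (2 ^ (2 * l + 3) * (n * (2 * l + 3 : ℕ) / s : ℝ) ^ (l + 2)) ^ (n * K)) ≤ 1 / 4 := by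
  have hs' : (0 : ℝ) < s := by exact_mod_cast hs
  have hn' : (0 : ℝ) < n := by exact_mod_cast hn
  have hK' : (1 : ℝ) ≤ K := by exact_mod_cast hK
  have h2n : 2 * n ≤ 2 * (n * K) := by nlinarith
  have hload := h.load_pow_mul_le hs (w := 2 * n) (by omega) h2n
  have hload1 := h.load_le_one hs (w := 2 * n) (by omega) h2n (by omega)
  have hcT := choose_le_three_mul_div_pow m (n * K)
  have hcS : (m.choose n : ℝ) ≤ 8 ^ (n * K) := by
    refine (choose_le_three_mul_div_pow m n).trans ?_
    rw [mul_comm n K, pow_mul]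
    gcongr
    have h1 : (m : ℝ) ≤ n * 2 ^ K := by exact_mod_cast hmK.le
    have h2 : (4 : ℝ) ≤ 4 ^ K := le_self_pow₀ (by norm_num) (by omega)
    rw [div_le_iff₀ hn', show (8 : ℝ) = 2 * 4 by norm_num, mul_pow]
    have h3 : (0 : ℝ) < 2 ^ K * n := by positivity
    nlinarith
  set y : ℝ := ((l + 2 : ℕ) * (2 * n : ℕ) : ℝ) / s with hy
  have hz : (n * (2 * l + 3 : ℕ) / s : ℝ) ≤ y := by
    rw [hy]
    gcongr ?_ / _
    push_cast
    nlinarith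
  have hy0 : 0 ≤ y := by positivity
  push_cast at hcT hload
  calc (m.choose n : ℝ) * (m.choose (n * K) *
      (2 ^ (2 * l + 3) * (n * (2 * l + 3 : ℕ) / s : ℝ) ^ (l + 2)) ^ (n * K))
      ≤ 8 ^ (n * K) * ((3 * m / (n * K)) ^ (n * K) *
        (2 ^ (2 * l + 3) * y ^ (l + 1)) ^ (n * K)) := by
        gcongr
        calc (n * (2 * l + 3 : ℕ) / s : ℝ) ^ (l + 2) ≤ y ^ (l + 2) := by gcongr
          _ ≤ y ^ (l + 1) := pow_le_pow_of_le_one hy0 hload1 (by omega)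
    _ = (24 * 2 ^ (2 * l + 3) / (n * K) * (y ^ (l + 1) * m)) ^ (n * K) := by
        rw [← mul_pow, ← mul_pow]
        congr 1
        ring
    _ ≤ (24 * 2 ^ (2 * l + 3) / (n * K) * (2 * n / 128 ^ (l + 1))) ^ (n * K) := by gcongr
    _ ≤ (1 / 4) ^ (n * K) := by
        gcongr
        have : (24 * 2 ^ (2 * l + 3) / (n * K) * (2 * n / 128 ^ (l + 1)) : ℝ) =
            96 * (1 / 32) ^ (l + 1) / K := by
          rw [show 2 * l + 3 = 2 * (l + 1) + 1 by ring, pow_succ, pow_mul,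
            show (128 : ℝ) = 2 ^ 2 * 32 by norm_num, mul_pow, div_pow, one_pow]
          field_simp
          norm_num
        rw [this, div_le_iff₀ (by positivity)]
        have : (1 / 32 : ℝ) ^ (l + 1) ≤ (1 / 32) ^ 2 :=
          pow_le_pow_of_le_one (by norm_num) (by norm_num) (by omega)
        linarith
    _ ≤ 1 / 4 := pow_le_of_le_one (by norm_num) (by norm_num) (by positivity)

theorem sum_Icc_one_quarter_pow_le (M : ℕ) :
    ∑ w ∈ Icc 1 M, (1 / 4 : ℝ) ^ w ≤ 1 / 3 := by
  have h : ∑ w ∈ Icc 1 M, (1 / 4 : ℝ) ^ w = 1 / 3 - 1 / 3 * (1 / 4) ^ M := by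
    induction M with
    | zero => simp
    | succ M ih => rw [sum_Icc_succ_top (by omega), ih, pow_succ]; ring
  rw [h]
  have : (0 : ℝ) < (1 / 4) ^ M := by positivity
  linarith

theorem exists_good_probes {m n K l s : ℕ} (hl : 1 ≤ l) (hn : 1 ≤ n) (hnm : n ≤ m)
    (hK : 1 ≤ K) (hmK : m < n * 2 ^ K) (h : SpaceBound m (2 * (n * K)) l s) :
    ∃ p : Fin m → Fin (2 * l + 3) → Fin s,
      (∀ S, #S = n → ∀ T, #T = n * K → Disjoint S T →
        ¬ ∀ u ∈ T, l + 2 ≤ #{i | p u i ∈ probedCells p S}) ∧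
      ∀ W, #W ≤ 2 * (n * K) → (l + 2) * #W ≤ #(probedCells p W) := by
  classical
  have hN : 0 < 2 * (n * K) := by positivity
  have hs : 0 < s := h.pos (by omega) hN
  have hs' : (0 : ℝ) < s := by exact_mod_cast hs
  set total : ℝ := (Fintype.card (Fin m → Fin (2 * l + 3) → Fin s) : ℝ) with htotal
  have htotal_pos : 0 < total := by
    have : Nonempty (Fin s) := ⟨⟨0, hs⟩⟩
    exact Nat.cast_pos.2 Fintype.card_pos
  let crowded : Finset (Fin m → Fin (2 * l + 3) → Fin s) :=
    (powersetCard n univ).biUnion fun S => (powersetCard (n * K) univ).biUnion fun T =>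
      {p | Disjoint S T ∧ ∀ u ∈ T, l + 2 ≤ #{i | p u i ∈ probedCells p S}}
  let confined : Finset (Fin m → Fin (2 * l + 3) → Fin s) :=
    (Icc 1 (min (2 * (n * K)) m)).biUnion fun w => (powersetCard w univ).biUnion fun W =>
      (powersetCard ((l + 2) * w) univ).biUnion fun Y => {p | probedCells p W ⊆ Y}
  have hcrowded : (#crowded : ℝ) ≤ 1 / 4 * total := by
    calc (#crowded : ℝ) ≤ ∑ S ∈ powersetCard n univ, ∑ T ∈ powersetCard (n * K) univ,
          (#{p : Fin m → Fin (2 * l + 3) → Fin s | Disjoint S T ∧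
            ∀ u ∈ T, l + 2 ≤ #{i | p u i ∈ probedCells p S}} : ℝ) := by
          exact_mod_cast card_biUnion_le.trans (sum_le_sum fun S _ => card_biUnion_le)
      _ ≤ ∑ S ∈ powersetCard n (univ : Finset (Fin m)),
          ∑ T ∈ powersetCard (n * K) (univ : Finset (Fin m)),
          (2 ^ (2 * l + 3) * (n * (2 * l + 3 : ℕ) / s : ℝ) ^ (l + 2)) ^ (n * K) * total := by
          refine sum_le_sum fun S hS => sum_le_sum fun T hT => ?_
          by_cases hST : Disjoint S T
          · simp only [hST, true_and]
            rw [← (mem_powersetCard.1 hT).2]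
            exact card_filter_crowded_le hs (mem_powersetCard.1 hS).2 hST
          · simp only [hST, false_and, filter_false, card_empty, Nat.cast_zero]
            positivity
      _ = (m.choose n : ℝ) * (m.choose (n * K) *
          (2 ^ (2 * l + 3) * (n * (2 * l + 3 : ℕ) / s : ℝ) ^ (l + 2)) ^ (n * K)) * total := by
          simp only [sum_const, card_powersetCard, card_univ, Fintype.card_fin, nsmul_eq_mul]
          ring
      _ ≤ 1 / 4 * total := by
          gcongr
          exact h.crowded_le hl hn hnm hK hmK hs
  have hconfined : (#confined : ℝ) ≤ 1 / 3 * total := by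
    calc (#confined : ℝ) ≤ ∑ w ∈ Icc 1 (min (2 * (n * K)) m), ∑ W ∈ powersetCard w univ,
          ∑ Y ∈ powersetCard ((l + 2) * w) univ,
          (#{p : Fin m → Fin (2 * l + 3) → Fin s | probedCells p W ⊆ Y} : ℝ) := by
          exact_mod_cast card_biUnion_le.trans (sum_le_sum fun w _ =>
            card_biUnion_le.trans (sum_le_sum fun W _ => card_biUnion_le))
      _ ≤ ∑ w ∈ Icc 1 (min (2 * (n * K)) m), ∑ W ∈ powersetCard w (univ : Finset (Fin m)),
          ∑ Y ∈ powersetCard ((l + 2) * w) (univ : Finset (Fin s)),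
          (((((l + 2) * w : ℕ) : ℝ) / s) ^ (2 * l + 3)) ^ w * total := by
          refine sum_le_sum fun w _ => sum_le_sum fun W hW => sum_le_sum fun Y hY => ?_
          have := card_filter_confined_le (t := 2 * l + 3) hs W Y
          rwa [(mem_powersetCard.1 hW).2, (mem_powersetCard.1 hY).2] at this
      _ = ∑ w ∈ Icc 1 (min (2 * (n * K)) m), (m.choose w : ℝ) * (s.choose ((l + 2) * w) *
          (((((l + 2) * w : ℕ) : ℝ) / s) ^ (2 * l + 3)) ^ w) * total := by
          refine sum_congr rfl fun w _ => ?_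
          simp only [sum_const, card_powersetCard, card_univ, Fintype.card_fin, nsmul_eq_mul]
          ring
      _ ≤ ∑ w ∈ Icc 1 (min (2 * (n * K)) m), (1 / 4 : ℝ) ^ w * total := by
          refine sum_le_sum fun w hw => ?_
          rw [mem_Icc] at hw
          gcongr
          exact h.confined_le hs (by omega) (by omega)
      _ ≤ 1 / 3 * total := by
          rw [← sum_mul]
          gcongr
          exact sum_Icc_one_quarter_pow_le _
  have hlt : #(crowded ∪ confined) < Fintype.card (Fin m → Fin (2 * l + 3) → Fin s) := by
    have h1 : (#(crowded ∪ confined) : ℝ) ≤ #crowded + #confined := by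
      exact_mod_cast card_union_le _ _
    have h2 : (#(crowded ∪ confined) : ℝ) < total := by linarith
    exact Nat.cast_lt.1 h2
  obtain ⟨p, hp⟩ : ∃ p, p ∉ crowded ∪ confined := by
    by_contra! hall
    rw [eq_univ_iff_forall.2 hall, card_univ] at hlt
    exact lt_irrefl _ hlt
  rw [mem_union, not_or] at hp
  refine ⟨p, fun S hS T hT hST hall => hp.1 ?_, fun W hW => ?_⟩
  · simp only [crowded, mem_biUnion, mem_powersetCard, mem_filter]
    exact ⟨S, ⟨subset_univ _, hS⟩, T, ⟨subset_univ _, hT⟩, mem_univ _, hST, hall⟩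
  · by_contra! hlt
    have hWm : #W ≤ m := by simpa using card_le_univ W
    have hWpos : 0 < #W := Nat.pos_of_ne_zero fun h0 => by simp [h0] at hlt
    have hload := h.load_le_one hs hWpos hW (by omega)
    rw [div_le_one hs'] at hload
    have hload' : (l + 2) * #W ≤ s := by exact_mod_cast hload
    obtain ⟨Y, hWY, hY⟩ := exists_superset_card_eq hlt.le (by simpa using hload')
    refine hp.2 ?_
    simp only [confined, mem_biUnion, mem_powersetCard, mem_filter, mem_Icc]
    exact ⟨#W, ⟨hWpos, le_min hW hWm⟩, W, ⟨subset_univ _, rfl⟩, Y, ⟨subset_univ _, hY⟩,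
      mem_univ _, hWY⟩

theorem nonAdaptiveSchemeExists_of_spaceBound {m n K l s : ℕ} (hl : 1 ≤ l) (hn : 1 ≤ n)
    (hnm : n ≤ m) (hK : 1 ≤ K) (hmK : m < n * 2 ^ K) (h : SpaceBound m (2 * (n * K)) l s) :
    NonAdaptiveSchemeExists m n s (2 * l + 3) := by
  classical
  obtain ⟨p, hcrowd, hexp⟩ := exists_good_probes hl hn hnm hK hmK h
  have hstore : ∀ S : Finset (Fin m), ∃ y : Fin s → Bool, #S ≤ n →
      ∀ u, (decide (l + 2 ≤ #{i | y (p u i) = true}) = true ↔ u ∈ S) := by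
    intro S
    by_cases hS : #S ≤ n
    swap
    · exact ⟨fun c => false, fun h => absurd h hS⟩
    obtain ⟨S', hSS', hS'⟩ := exists_superset_card_eq hS (by simpa using hnm)
    set T : Finset (Fin m) :=
      {u | u ∉ S' ∧ l + 2 ≤ #{i | p u i ∈ probedCells p S'}} with hT
    have hTcard : #T ≤ n * K := by
      by_contra! hlt
      obtain ⟨T', hT'T, hT'⟩ := exists_subset_card_eq hlt.le
      refine hcrowd S' hS' T' hT' ?_ fun u hu => (mem_filter.1 (hT'T hu)).2.2
      exact disjoint_right.2 fun u hu => (mem_filter.1 (hT'T hu)).2.1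
    have hcard : #(S' ∪ T) ≤ 2 * (n * K) := by
      have := card_union_le S' T
      nlinarith
    obtain ⟨y, hy⟩ := exists_storage (k := l + 2) (by omega) p S S' (S' ∪ T) hSS'
      (hSS'.trans subset_union_left) (fun V hV => hexp V ((card_le_card hV).trans hcard)) (by
        intro u hu
        by_contra! hge
        rw [mem_union, not_or] at hu
        exact hu.2 (mem_filter.2 ⟨mem_univ _, hu.1, hge⟩))
    exact ⟨y, fun _ => hy⟩
  choose φ hφ using hstore
  exact ⟨p, fun _ b => decide (l + 2 ≤ #{i | b i = true}), φ, fun S hS u => hφ S hS u⟩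

theorem exists_spaceBound_le {m n K l : ℕ} (hn : 1 ≤ n) (hnm : n ≤ m) (hK : 1 ≤ K) :
    ∃ s : ℕ, SpaceBound m (2 * (n * K)) l s ∧
      (s : ℝ) ≤ 258 * (l + 2) * (m : ℝ) ^ (1 / (l + 1) : ℝ) *
        (n : ℝ) ^ (1 - 1 / (l + 1) : ℝ) * K := by
  have hn' : (1 : ℝ) ≤ n := by exact_mod_cast hn
  have hm' : (1 : ℝ) ≤ m := by exact_mod_cast hn.trans hnm
  have hK' : (1 : ℝ) ≤ K := by exact_mod_cast hK
  have hl0 : (0 : ℝ) < l + 1 := by positivity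
  have hexp : (0 : ℝ) ≤ 1 - 1 / (l + 1) := by
    rw [sub_nonneg, div_le_one hl0]
    linarith [(Nat.cast_nonneg l : (0 : ℝ) ≤ l)]
  set X : ℝ := (m : ℝ) ^ (1 / (l + 1) : ℝ) * (2 * (n * K) : ℝ) ^ (1 - 1 / (l + 1) : ℝ) with hX
  have hXpow : X ^ (l + 1) = m * (2 * (n * K)) ^ l := by
    rw [hX, mul_pow, ← Real.rpow_mul_natCast (by positivity),
      ← Real.rpow_mul_natCast (by positivity)]
    push_cast
    rw [one_div_mul_cancel hl0.ne', Real.rpow_one, sub_mul, one_div_mul_cancel hl0.ne', one_mul,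
      add_sub_cancel_right, Real.rpow_natCast]
  have hXle : X ≤ (m : ℝ) ^ (1 / (l + 1) : ℝ) * (n : ℝ) ^ (1 - 1 / (l + 1) : ℝ) * (2 * K) := by
    rw [hX, mul_assoc, show (2 * (n * K) : ℝ) = n * (2 * K) by ring,
      Real.mul_rpow (by positivity) (by positivity)]
    gcongr
    refine Real.rpow_le_self_of_one_le (by linarith) ?_
    have : (0 : ℝ) < 1 / (l + 1) := by positivity
    linarith
  have hone : 1 ≤ (m : ℝ) ^ (1 / (l + 1) : ℝ) * (n : ℝ) ^ (1 - 1 / (l + 1) : ℝ) :=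
    one_le_mul_of_one_le_of_one_le (Real.one_le_rpow hm' (by positivity))
      (Real.one_le_rpow hn' hexp)
  refine ⟨⌈128 * (l + 2) * X⌉₊, ?_, ?_⟩
  · have hceil := Nat.le_ceil (128 * (l + 2) * X)
    have : ((128 * (l + 2)) ^ (l + 1) * (m * (2 * (n * K)) ^ l) : ℝ) ≤
        (⌈128 * (l + 2) * X⌉₊ : ℝ) ^ (l + 1) := by
      rw [← hXpow, ← mul_pow]
      gcongr
    unfold SpaceBound
    exact_mod_cast this
  · refine (Nat.ceil_lt_add_one (by positivity)).le.trans ?_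
    set P : ℝ := (m : ℝ) ^ (1 / (l + 1) : ℝ) * (n : ℝ) ^ (1 - 1 / (l + 1) : ℝ) with hP
    have h1 : 128 * (l + 2) * X ≤ 128 * (l + 2) * (P * (2 * K)) := by gcongr
    have hl2 : (1 : ℝ) ≤ l + 2 := by linarith
    have h2 : 1 ≤ (l + 2) * (P * K) :=
      one_le_mul_of_one_le_of_one_le hl2 (one_le_mul_of_one_le_of_one_le hone hK')
    calc 128 * (l + 2) * X + 1 ≤ 258 * ((l + 2) * (P * K)) := by nlinarith
      _ = _ := by rw [hP]; ring

end

/-- There is a constant `C > 0` such that for every odd integer `t ≥ 5`, for all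
sufficiently large `m` and all integers `n` with `1 ≤ n ≤ m`, there exists a
non-adaptive `(m,n,s,t)`-scheme with
`s ≤ C · t · m^(2/(t-1)) · n^(1-2/(t-1)) · log₂(2m/n)`. -/
theorem nonadaptive_upper_bound :
    ∃ C : ℝ, 0 < C ∧ ∀ t : ℕ, Odd t → 5 ≤ t → ∃ M : ℕ, ∀ m : ℕ, M ≤ m →
      ∀ n : ℕ, 1 ≤ n → n ≤ m → ∃ s : ℕ, NonAdaptiveSchemeExists m n s t ∧
        (s : ℝ) ≤ C * (t : ℝ) * (m : ℝ) ^ ((2 : ℝ) / ((t : ℝ) - 1)) *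
          (n : ℝ) ^ ((1 : ℝ) - 2 / ((t : ℝ) - 1)) *
          Real.logb 2 (2 * (m : ℝ) / (n : ℝ)) := by
  refine ⟨258, by norm_num, fun t ht ht5 => ⟨0, fun m _ n hn hnm => ?_⟩⟩
  obtain ⟨l, hl, rfl⟩ : ∃ l, 1 ≤ l ∧ t = 2 * l + 3 := by
    obtain ⟨r, rfl⟩ := ht
    exact ⟨r - 1, by omega, by omega⟩
  have hn' : (0 : ℝ) < n := by exact_mod_cast hn
  have hdiv : m / n ≠ 0 := (Nat.div_pos hnm hn).ne'
  set K := Nat.log 2 (m / n) + 1 with hKdef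
  have hmK : m < n * 2 ^ K := by
    have := Nat.lt_pow_succ_log_self one_lt_two (m / n)
    rw [mul_comm]
    exact (Nat.div_lt_iff_lt_mul hn).1 this
  have hKlog : (K : ℝ) ≤ Real.logb 2 (2 * (m : ℝ) / (n : ℝ)) := by
    have hle : 2 ^ Nat.log 2 (m / n) * n ≤ m :=
      (Nat.le_div_iff_mul_le hn).1 (Nat.pow_log_le_self 2 hdiv)
    have hle' : (2 ^ Nat.log 2 (m / n) * n : ℝ) ≤ m := by exact_mod_cast hle
    have hm' : (0 : ℝ) < m := by exact_mod_cast hn.trans hnm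
    rw [Real.le_logb_iff_rpow_le one_lt_two (by positivity), Real.rpow_natCast,
      le_div_iff₀ hn', hKdef, pow_succ]
    linarith
  obtain ⟨s, hs, hsle⟩ := exists_spaceBound_le (l := l) hn hnm (Nat.succ_pos _ : 1 ≤ K)
  refine ⟨s, nonAdaptiveSchemeExists_of_spaceBound hl hn hnm (Nat.succ_pos _) hmK hs,
    hsle.trans ?_⟩
  have hexp : (2 : ℝ) / (((2 * l + 3 : ℕ) : ℝ) - 1) = 1 / (l + 1) := by
    have : (l + 1 : ℝ) ≠ 0 := by positivity
    push_cast
    rw [show (2 * l + 3 - 1 : ℝ) = 2 * (l + 1) by ring]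
    field_simp
  rw [hexp]
  have hl2 : (l + 2 : ℝ) ≤ (2 * l + 3 : ℕ) := by
    push_cast
    linarith [(Nat.cast_nonneg l : (0 : ℝ) ≤ l)]
  gcongr
end

section
/- Let G be an (m,s)-query graph and let S ⊆ [m]. If the girth of G is greater than 4|S|, then the two-probe query scheme 𝒯_G is satisfiable for S. -/
/-- An `(m,s)`-query graph: a graph `G` on three disjoint sets of vertices `A`,
`A₀`, `A₁` (here `Sum.inl`, `Sum.inr ∘ Sum.inl`, `Sum.inr ∘ Sum.inr`, each a copy
of `Fin s`), in which every vertex of `A` has even degree, together with, for each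
`x ∈ [m]`, a triple `(i x, i0 x, i1 x) ∈ A × A₀ × A₁` such that `{i x, i0 x}` and
`{i x, i1 x}` are edges of `G`; both edges are labeled `x`, and no edge receives
more than one label (expressed by the two injectivity conditions). -/
structure QueryGraph (m s : ℕ) where
  G : SimpleGraph (Fin s ⊕ (Fin s ⊕ Fin s))
  i : Fin m → Fin s
  i0 : Fin m → Fin s
  i1 : Fin m → Fin s
  adj0 : ∀ x : Fin m, G.Adj (Sum.inl (i x)) (Sum.inr (Sum.inl (i0 x)))
  adj1 : ∀ x : Fin m, G.Adj (Sum.inl (i x)) (Sum.inr (Sum.inr (i1 x)))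
  evenDeg : ∀ v : Fin s, Even (G.neighborSet (Sum.inl v)).ncard
  label0 : Function.Injective (fun x : Fin m => (i x, i0 x))
  label1 : Function.Injective (fun x : Fin m => (i x, i1 x))

/-- The systematic two-probe query scheme `𝒯_G` associated with a query graph is
satisfiable for `S` if there is an assignment of bits to the three arrays `A`,
`A₀`, `A₁` under which every query "Is `x` in `S`?" is answered correctly:
on query `x` the scheme reads `A[i x]`; if it is `1` it returns `A₁[i1 x]`,
else it returns `A₀[i0 x]`. -/
def QueryGraph.Satisfiable {m s : ℕ} (Q : QueryGraph m s) (S : Finset (Fin m)) : Prop :=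
  ∃ A A0 A1 : Fin s → Bool,
    ∀ x : Fin m, ((if A (Q.i x) then A1 (Q.i1 x) else A0 (Q.i0 x)) = true ↔ x ∈ S)

/-- Every edge of an acyclic graph joins some vertex to its parent, for a suitable choice of
parents (root each component and walk towards the root). -/
theorem SimpleGraph.IsAcyclic.exists_parent {V : Type*} {G : SimpleGraph V} (hG : G.IsAcyclic) :
    ∃ π : V → V, ∀ v w, G.Adj v w → π v = w ∨ π w = v := by
  have hreach : ∀ v, G.Reachable (G.connectedComponentMk v).out v := fun v =>
    SimpleGraph.ConnectedComponent.exact (Quot.out_eq _)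
  choose p hp using fun v => (hreach v).exists_isPath
  have huniq : ∀ v, ∀ q : G.Walk (G.connectedComponentMk v).out v, q.IsPath →
      q.penultimate = (p v).penultimate := fun v q hq =>
    congrArg (fun r : G.Path _ _ => r.1.penultimate)
      ((hG.subsingleton_path _ v).elim ⟨q, hq⟩ ⟨p v, hp v⟩)
  refine ⟨fun v => (p v).penultimate, fun v w hvw => ?_⟩
  obtain ⟨q, hq⟩ : ∃ q : G.Walk (G.connectedComponentMk v).out w, q.IsPath :=
    ((hreach v).trans hvw.reachable).exists_isPath
  have hqw : q.penultimate = (p w).penultimate := by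
    have hc : G.connectedComponentMk v = G.connectedComponentMk w :=
      SimpleGraph.ConnectedComponent.sound hvw.reachable
    have h := huniq w
    generalize (p w).penultimate = z at h ⊢
    rw [← hc] at h
    exact h q hq
  by_cases hw : w ∈ (p v).support
  · exact Or.inl (hG.eq_penultimate_of_adj_end (hp v) hvw hw).symm
  · have hv := hG.mem_support_of_ne_mem_support_of_adj_of_isPath hq (hp v) hvw.symm hw
    exact Or.inr (hqw.symm.trans (hG.eq_penultimate_of_adj_end hq hvw.symm hv).symm)

/-- A cycle all of whose edges are covered by a finite set `U` of vertices has length at most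
`2 * #U`. -/
theorem SimpleGraph.Walk.IsCycle.length_le_of_cover {V : Type*} {G : SimpleGraph V}
    {a : V} {c : G.Walk a a} (hc : c.IsCycle) (U : Finset V)
    (hU : ∀ v w, G.Adj v w → v ∈ U ∨ w ∈ U) : c.length ≤ 2 * U.card := by
  classical
  have count_le : ∀ l : List V, l.Nodup → l.countP (· ∈ U) ≤ U.card := fun l hl => by
    rw [List.countP_eq_length_filter, ← List.toFinset_card_of_nodup (hl.filter _)]
    exact Finset.card_le_card fun v hv => by simp_all
  have hfst : (c.darts.map (·.fst)).countP (· ∈ U) ≤ U.card := count_le _ <| by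
    rw [SimpleGraph.Walk.map_fst_darts]
    exact hc.nodup_dropLast_support
  have hsnd : (c.darts.map (·.snd)).countP (· ∈ U) ≤ U.card := count_le _ <| by
    rw [SimpleGraph.Walk.map_snd_darts]
    exact hc.support_nodup
  have hcover : ∀ l : List G.Dart, l.length ≤
      (l.map (·.fst)).countP (· ∈ U) + (l.map (·.snd)).countP (· ∈ U) := fun l => by
    induction l with
    | nil => simp
    | cons d l ih =>
      have := hU _ _ d.adj
      simp only [List.map_cons, List.countP_cons, List.length_cons, decide_eq_true_eq]
      split_ifs <;> first | omega | tauto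
  have := hcover c.darts
  rw [SimpleGraph.Walk.length_darts] at this
  omega

/-- If the girth of an `(m,s)`-query graph `G` is greater than `4|S|`, then the
two-probe query scheme `𝒯_G` is satisfiable for `S`. -/
theorem satisfiable_of_girth_gt {m s : ℕ} (Q : QueryGraph m s) (S : Finset (Fin m))
    (h : (4 * S.card : ℕ∞) < Q.G.egirth) : Q.Satisfiable S := by
  classical
  let U : Finset (Fin s ⊕ (Fin s ⊕ Fin s)) :=
    S.image (fun x => Sum.inr (Sum.inl (Q.i0 x))) ∪ S.image (fun x => Sum.inr (Sum.inr (Q.i1 x)))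
  have hU : U.card ≤ 2 * S.card := by
    calc U.card ≤ _ := Finset.card_union_le _ _
      _ ≤ S.card + S.card := add_le_add Finset.card_image_le Finset.card_image_le
      _ = 2 * S.card := (two_mul _).symm
  let H : SimpleGraph (Fin s ⊕ (Fin s ⊕ Fin s)) :=
    { Adj := fun v w => Q.G.Adj v w ∧ (v ∈ U ∨ w ∈ U)
      symm := ⟨fun _ _ hvw => ⟨hvw.1.symm, hvw.2.symm⟩⟩
      loopless := ⟨fun _ hv => hv.1.ne rfl⟩ }
  have hHG : H ≤ Q.G := fun _ _ hvw => hvw.1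
  have hH : H.IsAcyclic := fun a c hc => by
    have hlen := hc.length_le_of_cover U fun _ _ hvw => hvw.2
    have hgirth := SimpleGraph.egirth_le_length (hc.mapLe hHG)
    rw [SimpleGraph.Walk.length_mapLe] at hgirth
    have : 4 * S.card < c.length := by exact_mod_cast h.trans_le hgirth
    omega
  obtain ⟨π, hπ⟩ := hH.exists_parent
  -- Each vertex of `A` selects the side not containing its parent, so a vertex of `A₀` or `A₁`
  -- can only be read from its own parent.
  refine ⟨fun v => decide (∃ u, π (Sum.inl v) = Sum.inr (Sum.inl u)),
    fun u => decide (∃ x ∈ S, Q.i0 x = u ∧ π (Sum.inr (Sum.inl u)) = Sum.inl (Q.i x)),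
    fun u => decide (∃ x ∈ S, Q.i1 x = u ∧ π (Sum.inr (Sum.inr u)) = Sum.inl (Q.i x)),
    fun x => ?_⟩
  have hparent0 : (¬ ∃ u, π (Sum.inl (Q.i x)) = Sum.inr (Sum.inl u)) → ∀ y ∈ S,
      Q.i0 y = Q.i0 x → π (Sum.inr (Sum.inl (Q.i0 x))) = Sum.inl (Q.i x) := fun hx y hy hyx =>
    (hπ _ _ ⟨Q.adj0 x, Or.inr (Finset.mem_union_left _
      (Finset.mem_image.2 ⟨y, hy, by rw [hyx]⟩))⟩).resolve_left fun h => hx ⟨_, h⟩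
  have hparent1 : (∃ u, π (Sum.inl (Q.i x)) = Sum.inr (Sum.inl u)) → ∀ y ∈ S,
      Q.i1 y = Q.i1 x → π (Sum.inr (Sum.inr (Q.i1 x))) = Sum.inl (Q.i x) := fun ⟨u, hu⟩ y hy hyx =>
    (hπ _ _ ⟨Q.adj1 x, Or.inr (Finset.mem_union_right _
      (Finset.mem_image.2 ⟨y, hy, by rw [hyx]⟩))⟩).resolve_left fun h => by simp [hu] at h
  simp only [decide_eq_true_eq]
  split_ifs with hx
  · simp only [decide_eq_true_eq]
    refine ⟨fun ⟨y, hy, hyx, hyπ⟩ => ?_, fun hxS => ⟨x, hxS, rfl, hparent1 hx x hxS rfl⟩⟩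
    have hi : Q.i x = Q.i y := Sum.inl_injective ((hparent1 hx y hy hyx).symm.trans hyπ)
    exact Q.label1 (Prod.ext hi.symm hyx) ▸ hy
  · simp only [decide_eq_true_eq]
    refine ⟨fun ⟨y, hy, hyx, hyπ⟩ => ?_, fun hxS => ⟨x, hxS, rfl, hparent0 hx x hxS rfl⟩⟩
    have hi : Q.i x = Q.i y := Sum.inl_injective ((hparent0 hx y hy hyx).symm.trans hyπ)
    exact Q.label0 (Prod.ext hi.symm hyx) ▸ hy
end
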